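/- arXiv:1107.5600 — 3 statements merged into one kernel-verified Lean document; each statement's English description precedes it below -/
import Mathlib

section
/- Let G be an additively written abelian group, let n ≥ 1 and c ≥ 1 be integers, and let α ∈ G. Suppose that for all positive integers k, l with k ≡ l (mod n) there exist natural numbers a, b (depending on k and l) such that (k^a · l^b · (l^c − k^c)) · α = 0 in G. Then α has finite additive order, and this order divides 2 · n · c · ∏ p, where the (finite) product runs over all primes p such that p does not divide n and (p−1) divides c (any such prime satisfies p ≤ c + 1). -/
/-- If a prime `p` is coprime to `n` and `p - 1 ∤ c`, some positive `l ≡ 1 [MOD n]` is prime to `p`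
and satisfies `l ^ c ≢ 1` modulo `p`. -/
theorem exists_modEq_one_and_not_dvd_pow_sub_one {p n c : ℕ} (hp : p.Prime) (hpn : ¬ p ∣ n)
    (hc : ¬ (p - 1) ∣ c) :
    ∃ l : ℕ, 0 < l ∧ 1 ≡ l [MOD n] ∧ ¬ (p : ℤ) ∣ l ∧ ¬ (p : ℤ) ∣ (l : ℤ) ^ c - 1 := by
  have : Fact p.Prime := ⟨hp⟩
  obtain ⟨g, hg⟩ := IsCyclic.exists_generator (α := (ZMod p)ˣ)
  have horder : orderOf g = p - 1 := by
    rw [orderOf_eq_card_of_forall_mem_zpowers hg, Nat.card_eq_fintype_card, ZMod.card_units]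
  obtain ⟨l, hln, hlp⟩ :=
    Nat.chineseRemainder ((Nat.Prime.coprime_iff_not_dvd hp).2 hpn).symm 1 (g : ZMod p).val
  have hlg : (l : ZMod p) = g := by
    rw [(ZMod.natCast_eq_natCast_iff _ _ _).2 hlp, ZMod.natCast_zmod_val]
  have hl : ¬ (p : ℤ) ∣ l := by
    rw [← ZMod.intCast_zmod_eq_zero_iff_dvd, Int.cast_natCast, hlg]
    exact g.ne_zero
  refine ⟨l, Nat.pos_of_ne_zero ?_, hln.symm, hl, fun h => hc ?_⟩
  · rintro rfl
    simp at hl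
  · rw [← ZMod.intCast_zmod_eq_zero_iff_dvd] at h
    push_cast at h
    rw [hlg, sub_eq_zero] at h
    rw [← horder, orderOf_dvd_iff_pow_eq_one]
    exact Units.ext (by simpa using h)

/-- Lifting the exponent at `1 + M`, uniformly in the prime `p ∣ M`. -/
theorem emultiplicity_one_add_pow_sub_one {p M : ℕ} (hp : p.Prime) (hpM : p ∣ M) (hM : 4 ∣ M)
    (c : ℕ) :
    emultiplicity (p : ℤ) ((1 + M : ℤ) ^ c - 1) = emultiplicity p (M * c) := by
  have hpM' : (p : ℤ) ∣ M := Int.natCast_dvd_natCast.2 hpM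
  have hnot : ¬ (p : ℤ) ∣ 1 + M := fun h =>
    (Nat.prime_iff_prime_int.1 hp).not_dvd_one ((Int.dvd_add_left hpM').1 h)
  rw [emultiplicity_mul hp.prime, ← Int.natCast_emultiplicity p M]
  rcases hp.eq_two_or_odd' with rfl | hodd
  · have h4 : (4 : ℤ) ∣ (1 + M) - 1 := by
      simpa using Int.natCast_dvd_natCast.2 hM
    have := Int.two_pow_sub_pow' c h4 (by simpa using hnot)
    rw [one_pow] at this
    rw [← Int.natCast_emultiplicity 2 c]
    simpa using this
  · have := Int.emultiplicity_pow_sub_pow hp hodd (x := 1 + M) (y := 1) (by simpa using hpM') hnot c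
    rw [one_pow] at this
    simpa using this

/-- Lemma 4.5 of Maillot–Rössler: if for all positive `k ≡ l [MOD n]` some
multiple `k^a * l^b * (l^c - k^c)` kills `α`, then `α` has finite order dividing
`2 * n * c * ∏ p` over primes `p ∤ n` with `(p - 1) ∣ c` (all such primes are
`≤ c + 1`). -/
theorem lemma_4_5 {G : Type*} [AddCommGroup G] (n c : ℕ) (hn : 1 ≤ n) (hc : 1 ≤ c)
    (α : G)
    (h : ∀ k l : ℕ, 0 < k → 0 < l → k ≡ l [MOD n] →
      ∃ a b : ℕ, ((k : ℤ) ^ a * (l : ℤ) ^ b * ((l : ℤ) ^ c - (k : ℤ) ^ c)) • α = 0) :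
    addOrderOf α ≠ 0 ∧
      addOrderOf α ∣
        2 * n * c *
          ∏ p ∈ Finset.filter (fun p => Nat.Prime p ∧ ¬ p ∣ n ∧ (p - 1) ∣ c)
            (Finset.range (c + 2)), p := by
  have hdvd : ∀ l : ℕ, 0 < l → 1 ≡ l [MOD n] →
      ∃ b : ℕ, (addOrderOf α : ℤ) ∣ (l : ℤ) ^ b * ((l : ℤ) ^ c - 1) := fun l hl hln => by
    obtain ⟨a, b, hab⟩ := h 1 l one_pos hl hln
    exact ⟨b, by simpa using addOrderOf_dvd_iff_zsmul_eq_zero.2 hab⟩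
  set P := ∏ p ∈ Finset.filter (fun p => Nat.Prime p ∧ ¬ p ∣ n ∧ (p - 1) ∣ c)
    (Finset.range (c + 2)), p
  have hdvdP : ∀ p : ℕ, p.Prime → ¬ p ∣ n → (p - 1) ∣ c → p ∣ P := fun p hp hpn hpc => by
    have := Nat.le_of_dvd hc hpc
    exact Finset.dvd_prod_of_mem (fun p : ℕ => p)
      (Finset.mem_filter.2 ⟨Finset.mem_range.2 (by omega), hp, hpn, hpc⟩)
  have hP0 : P ≠ 0 := Finset.prod_ne_zero_iff.2 fun p hp => (Finset.mem_filter.1 hp).2.1.ne_zero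
  set M := 2 * n * P with hM
  have hM0 : M ≠ 0 := by positivity
  have hM4 : 4 ∣ M := by
    have h2 : 2 ∣ n * P := by
      by_cases h2n : 2 ∣ n
      · exact h2n.mul_right P
      · exact (hdvdP 2 Nat.prime_two h2n (one_dvd c)).mul_left n
    rw [hM, mul_assoc]
    exact mul_dvd_mul_left 2 h2
  have hpM : ∀ p : ℕ, p.Prime → p ∣ addOrderOf α → p ∣ M := fun p hp hpα => by
    by_cases hpn : p ∣ n
    · exact (hpn.mul_left 2).mul_right P
    by_cases hpc : (p - 1) ∣ c
    · exact (hdvdP p hp hpn hpc).mul_left _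
    obtain ⟨l, hl, hln, hpl, hplc⟩ := exists_modEq_one_and_not_dvd_pow_sub_one hp hpn hpc
    obtain ⟨b, hb⟩ := hdvd l hl hln
    have hp' := Nat.prime_iff_prime_int.1 hp
    rcases hp'.dvd_or_dvd ((Int.natCast_dvd_natCast.2 hpα).trans hb) with hd | hd
    · exact absurd (hp'.dvd_of_dvd_pow hd) hpl
    · exact absurd hd hplc
  have hmod : 1 ≡ 1 + M [MOD n] := by
    have hnM : n ∣ M := (dvd_mul_left n 2).mul_right P
    exact (Nat.modEq_iff_dvd' (Nat.le_add_right 1 M)).2 (by simpa using hnM)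
  obtain ⟨b, hb⟩ := hdvd (1 + M) (by omega) hmod
  have hcop : Nat.Coprime (addOrderOf α) (1 + M) := Nat.coprime_of_dvd fun p hp hpα hpl =>
    hp.one_lt.ne' (Nat.dvd_one.1 ((Nat.dvd_add_left (hpM p hp hpα)).1 hpl))
  have hb' : (addOrderOf α : ℤ) ∣ (1 + M : ℤ) ^ c - 1 := by
    have hcop' : IsCoprime (addOrderOf α : ℤ) ((1 + M : ℕ) : ℤ) := Nat.isCoprime_iff_coprime.2 hcop
    simpa using hcop'.pow_right.dvd_of_dvd_mul_left hb
  have hα0 : addOrderOf α ≠ 0 := fun h0 => by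
    rw [h0, Nat.cast_zero, zero_dvd_iff, sub_eq_zero] at hb'
    have : 1 < (1 + M) ^ c := Nat.one_lt_pow (by omega) (by omega)
    have hb'' : (1 + M) ^ c = 1 := by exact_mod_cast hb'
    omega
  refine ⟨hα0, ?_⟩
  have hgoal : addOrderOf α ∣ M * c := by
    refine (Nat.dvd_iff_prime_pow_dvd_dvd _ _).2 fun p k hp hpk => ?_
    rcases Nat.eq_zero_or_pos k with rfl | hk
    · simp
    have hpα : p ∣ addOrderOf α := (dvd_pow_self p hk.ne').trans hpk
    rw [pow_dvd_iff_le_emultiplicity,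
      ← emultiplicity_one_add_pow_sub_one hp (hpM p hp hpα) hM4, ← pow_dvd_iff_le_emultiplicity]
    exact dvd_trans (by exact_mod_cast hpk) hb'
  rwa [hM, mul_right_comm] at hgoal
end

section
/- Let G be an additively written abelian group, let n ≥ 1 and c ≥ 1 be integers, and let α ∈ G. Suppose that for all positive integers k, l with k ≡ l (mod n) there exist natural numbers a, b (depending on k and l) such that (k^a · l^b · (l^c − k^c)) · α = 0 in G. Then the additive order of α divides F₂ · ∏₁ · ∏₂, where: ∏₁ = ∏ p^{1 + v_p(c)} over all odd primes p with p ∤ n and (p−1) ∣ c; ∏₂ = ∏ p^{v_p(n) + v_p(c)} over all odd primes p dividing n; and F₂ = 2 if both n and c are odd, F₂ = 2^{2 + v₂(c)} if n is odd and c is even, and F₂ = 2^{v₂(n) + v₂(c) + w₂} if n is even, where w₂ = 1 if v₂(n) = 1 and c is even, and w₂ = 0 otherwise. -/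
/-- Lifting the exponent at base point `1`: under the usual restriction at `2`, a prime power
dividing `(1 + m) ^ c - 1` already divides `m * c`. -/
lemma prime_pow_dvd_mul_of_dvd_one_add_pow_sub_one {p m c j : ℕ} (hp : p.Prime) (hpm : p ∣ m)
    (h2 : p ≠ 2 ∨ 4 ∣ m ∨ ¬ p ∣ c)
    (hj : ((p ^ j : ℕ) : ℤ) ∣ ((1 + m : ℕ) : ℤ) ^ c - 1) : p ^ j ∣ m * c := by
  have hpZ : Prime (p : ℤ) := Nat.prime_iff_prime_int.mp hp
  have hsub : ((1 + m : ℕ) : ℤ) - 1 = (m : ℤ) := by push_cast; ring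
  have hdvd : (p : ℤ) ∣ ((1 + m : ℕ) : ℤ) - 1 := by
    rw [hsub]; exact_mod_cast hpm
  have hndvd : ¬ (p : ℤ) ∣ ((1 + m : ℕ) : ℤ) := by
    rw [Int.natCast_dvd_natCast, Nat.dvd_add_left hpm, Nat.dvd_one]
    exact hp.ne_one
  have key : emultiplicity (p : ℤ) (((1 + m : ℕ) : ℤ) ^ c - 1 ^ c) =
      emultiplicity (p : ℤ) (m : ℤ) + emultiplicity (p : ℤ) (c : ℤ) := by
    by_cases hpc : p ∣ c
    · by_cases hp2 : p = 2
      · subst hp2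
        have h4 : 4 ∣ m := by tauto
        have := Int.two_pow_sub_pow' (x := ((1 + m : ℕ) : ℤ)) (y := 1) c
          (by rw [hsub]; exact_mod_cast h4) (by exact_mod_cast hndvd)
        rw [hsub] at this
        exact this
      · have := Int.emultiplicity_pow_sub_pow hp (hp.odd_of_ne_two hp2) hdvd hndvd c
        rw [hsub] at this
        rw [this, Int.natCast_emultiplicity p c]
    · have hpc' : ¬ (p : ℤ) ∣ (c : ℤ) := by rwa [Int.natCast_dvd_natCast]
      rw [emultiplicity_pow_sub_pow_of_prime hpZ hdvd hndvd hpc', hsub,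
        emultiplicity_eq_zero.mpr hpc', add_zero]
  rw [one_pow, ← emultiplicity_mul hpZ] at key
  rw [Nat.cast_pow, pow_dvd_iff_le_emultiplicity, key, ← pow_dvd_iff_le_emultiplicity] at hj
  exact_mod_cast hj

/-- A prime power dividing `m * c` divides `p ^ (v_p(m) + v_p(c))`. -/
lemma prime_pow_dvd_pow_padicValNat_add {p m c j : ℕ} (hp : p.Prime) (hm : m ≠ 0) (hc : c ≠ 0)
    (hj : p ^ j ∣ m * c) : p ^ j ∣ p ^ (padicValNat p m + padicValNat p c) := by
  have := Fact.mk hp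
  rw [← padicValNat.mul hm hc]
  exact pow_dvd_pow p ((padicValNat_dvd_iff_le (mul_ne_zero hm hc)).mp hj)

/-- If `p ∤ n` and `p - 1 ∤ c`, some `l ≡ 1 (mod n)` prime to `p` has `l ^ c ≢ 1 (mod p)`. -/
lemma exists_modEq_one_not_dvd_pow_sub_one {p n c : ℕ} (hp : p.Prime) (hpn : ¬ p ∣ n)
    (hpc : ¬ (p - 1) ∣ c) :
    ∃ l : ℕ, 1 ≡ l [MOD n] ∧ ¬ p ∣ l ∧ ¬ (p : ℤ) ∣ (l : ℤ) ^ c - 1 := by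
  have := Fact.mk hp
  obtain ⟨g, hg⟩ := IsCyclic.exists_generator (α := (ZMod p)ˣ)
  have hord : orderOf g = p - 1 := by
    rw [orderOf_eq_card_of_forall_mem_zpowers hg, Nat.card_eq_fintype_card, ZMod.card_units]
  obtain ⟨l, hlp, hln⟩ :=
    Nat.chineseRemainder ((Nat.Prime.coprime_iff_not_dvd hp).mpr hpn) (g : ZMod p).val 1
  have hl : (l : ZMod p) = g := by
    rw [(ZMod.natCast_eq_natCast_iff _ _ _).mpr hlp, ZMod.natCast_zmod_val]
  refine ⟨l, hln.symm, fun hd => ?_, fun hd => hpc ?_⟩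
  · rw [← ZMod.natCast_eq_zero_iff, hl] at hd
    exact g.ne_zero hd
  · rw [← ZMod.intCast_zmod_eq_zero_iff_dvd] at hd
    push_cast at hd
    rw [hl, sub_eq_zero] at hd
    rw [← hord]
    exact orderOf_dvd_of_pow_eq_one (Units.ext (by push_cast; exact hd))

/-- The precise assertion at the end of the proof of Lemma 4.5 of
Maillot–Rössler: the order of `α` divides `F₂ * ∏₁ * ∏₂`, where `∏₁` runs over
odd primes `p ∤ n` with `(p-1) ∣ c` (so `p ≤ c + 1`), `∏₂` runs over odd primes
`p ∣ n`, and `F₂` is the explicit `2`-part. -/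
theorem lemma_4_5_precise {G : Type*} [AddCommGroup G] (n c : ℕ) (hn : 1 ≤ n)
    (hc : 1 ≤ c) (α : G)
    (h : ∀ k l : ℕ, 0 < k → 0 < l → k ≡ l [MOD n] →
      ∃ a b : ℕ, ((k : ℤ) ^ a * (l : ℤ) ^ b * ((l : ℤ) ^ c - (k : ℤ) ^ c)) • α = 0) :
    addOrderOf α ∣
      (if Odd n then (if Odd c then 2 else 2 ^ (2 + padicValNat 2 c))
        else 2 ^ (padicValNat 2 n + padicValNat 2 c +
          (if padicValNat 2 n = 1 ∧ Even c then 1 else 0))) *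
      (∏ p ∈ Finset.filter (fun p => Nat.Prime p ∧ p ≠ 2 ∧ ¬ p ∣ n ∧ (p - 1) ∣ c)
          (Finset.range (c + 2)), p ^ (1 + padicValNat p c)) *
      (∏ p ∈ Finset.filter (fun p => Nat.Prime p ∧ p ≠ 2 ∧ p ∣ n)
          (Finset.range (n + 1)), p ^ (padicValNat p n + padicValNat p c)) := by
  have hn0 : n ≠ 0 := by omega
  have hc0 : c ≠ 0 := by omega
  rw [Nat.dvd_iff_prime_pow_dvd_dvd]
  intro p j hp hj
  have := Fact.mk hp
  have hdvd : ∀ l : ℕ, 1 ≡ l [MOD n] → ¬ p ∣ l →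
      ((p ^ j : ℕ) : ℤ) ∣ (l : ℤ) ^ c - 1 := by
    intro l hl hpl
    have hl0 : 0 < l := Nat.pos_of_ne_zero fun h0 => hpl (h0 ▸ dvd_zero p)
    obtain ⟨a, b, hab⟩ := h 1 l one_pos hl0 hl
    rw [← addOrderOf_dvd_iff_zsmul_eq_zero] at hab
    have hpj := (Int.natCast_dvd_natCast.mpr hj).trans hab
    simp only [Nat.cast_one, one_pow, one_mul] at hpj
    refine IsCoprime.dvd_of_dvd_mul_left ?_ hpj
    have : Nat.Coprime (p ^ j) (l ^ b) :=
      Nat.Coprime.pow _ _ ((Nat.Prime.coprime_iff_not_dvd hp).mpr hpl)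
    exact_mod_cast Nat.isCoprime_iff_coprime.mpr this
  have hlift : ∀ t : ℕ, t ≠ 0 → p ∣ n * t → (p ≠ 2 ∨ 4 ∣ n * t ∨ ¬ p ∣ c) →
      p ^ j ∣ p ^ (padicValNat p n + padicValNat p t + padicValNat p c) := by
    intro t ht hpt h2
    rw [← padicValNat.mul hn0 ht]
    refine prime_pow_dvd_pow_padicValNat_add hp (mul_ne_zero hn0 ht) hc0
      (prime_pow_dvd_mul_of_dvd_one_add_pow_sub_one hp hpt h2 (hdvd _ ?_ ?_))
    · exact (Nat.modEq_iff_dvd' (by omega)).mpr (by simp)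
    · rw [Nat.dvd_add_left hpt, Nat.dvd_one]
      exact hp.ne_one
  by_cases hp2 : p = 2
  · subst hp2
    refine Dvd.dvd.mul_right (Dvd.dvd.mul_right ?_ _) _
    have hv2 : padicValNat 2 2 = 1 := padicValNat_self
    have hv4 : padicValNat 2 4 = 2 := padicValNat.prime_pow (p := 2) 2
    have hodd : ∀ m : ℕ, Odd m → padicValNat 2 m = 0 := fun m hm =>
      padicValNat.eq_zero_of_not_dvd hm.not_two_dvd_nat
    split_ifs with hno hco hw
    · have := hlift 2 two_ne_zero (dvd_mul_left _ _) (Or.inr (Or.inr hco.not_two_dvd_nat))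
      simpa [hodd n hno, hodd c hco, hv2] using this
    · have := hlift 4 four_ne_zero (dvd_mul_of_dvd_right (by norm_num) _)
        (Or.inr (Or.inl (dvd_mul_left _ _)))
      simpa [hodd n hno, hv4] using this
    · have hn2 : 2 ∣ n := even_iff_two_dvd.mp (Nat.not_odd_iff_even.mp hno)
      have := hlift 2 two_ne_zero (dvd_mul_left _ _)
        (Or.inr (Or.inl (mul_dvd_mul hn2 (dvd_refl 2))))
      rwa [hv2, add_right_comm] at this
    · have hn2 : 2 ∣ n := even_iff_two_dvd.mp (Nat.not_odd_iff_even.mp hno)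
      have := hlift 1 one_ne_zero (by simpa using hn2) (Or.inr ?_)
      · simpa using this
      · by_cases hce : 2 ∣ c
        · left
          have h1 : 1 ≤ padicValNat 2 n := one_le_padicValNat_of_dvd hn0 hn2
          have h2 : padicValNat 2 n ≠ 1 := fun h1 => hw ⟨h1, even_iff_two_dvd.mpr hce⟩
          have : 2 ^ 2 ∣ n := (padicValNat_dvd_iff_le hn0).mpr (by omega)
          simpa using this
        · exact Or.inr hce
  · by_cases hpn : p ∣ n
    · refine Dvd.dvd.mul_left (Dvd.dvd.trans ?_ (Finset.dvd_prod_of_mem _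
        (Finset.mem_filter.mpr ⟨Finset.mem_range.mpr ?_, hp, hp2, hpn⟩))) _
      · simpa using hlift 1 one_ne_zero (by simpa using hpn) (Or.inl hp2)
      · exact Nat.lt_succ_of_le (Nat.le_of_dvd hn hpn)
    · by_cases hpc : (p - 1) ∣ c
      · refine Dvd.dvd.mul_right (Dvd.dvd.mul_left (Dvd.dvd.trans ?_ (Finset.dvd_prod_of_mem _
          (Finset.mem_filter.mpr ⟨Finset.mem_range.mpr ?_, hp, hp2, hpn, hpc⟩))) _) _
        · simpa [padicValNat.eq_zero_of_not_dvd hpn] using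
            hlift p hp.ne_zero (dvd_mul_left _ _) (Or.inl hp2)
        · have := Nat.le_of_dvd hc hpc
          omega
      · obtain ⟨l, hln, hpl, hlc⟩ := exists_modEq_one_not_dvd_pow_sub_one hp hpn hpc
        have hj0 : j = 0 := by
          by_contra hj0
          exact hlc ((Int.natCast_dvd_natCast.mpr (dvd_pow_self p hj0)).trans (hdvd l hln hpl))
        simp [hj0]
end

section
/- Let n ≥ 1 be an integer, let p be a prime dividing n, set β := v_p(n) (so β ≥ 1), and let δ ≥ β. Then for a unit u of ℤ/p^δℤ the following are equivalent: (i) the image of u under the canonical reduction ring homomorphism ℤ/p^δℤ → ℤ/p^βℤ equals 1; (ii) there exist positive integers k, l with k ≡ l (mod n), p ∤ k, p ∤ l, and l ≡ u · k (mod p^δ). In other words, the set C of residues l·k^{−1} over all admissible pairs (k, l) equals the kernel K of the reduction map (ℤ/p^δℤ)^* → (ℤ/p^βℤ)^*. -/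
/-- Case 2 (`p ∣ n`) in the proof of Lemma 4.5: with `β = v_p(n) ≤ δ`, a unit
`u` of `ℤ/p^δℤ` is a ratio `l/k` for admissible pairs `(k, l)` if and only if it
reduces to `1` in `ℤ/p^βℤ`, i.e. the set `C` equals the kernel `K` of the
reduction map. -/
theorem ratio_set_eq_reduction_kernel (n : ℕ) (hn : 1 ≤ n) (p : ℕ)
    (hp : p.Prime) (hpn : p ∣ n) (δ : ℕ) (hδ : padicValNat p n ≤ δ)
    (u : (ZMod (p ^ δ))ˣ) :
    ZMod.castHom (pow_dvd_pow p hδ) (ZMod (p ^ padicValNat p n))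
        (u : ZMod (p ^ δ)) = 1 ↔
      ∃ k l : ℕ, 0 < k ∧ 0 < l ∧ k ≡ l [MOD n] ∧ ¬ p ∣ k ∧ ¬ p ∣ l ∧
        (l : ZMod (p ^ δ)) = (u : ZMod (p ^ δ)) * (k : ZMod (p ^ δ)) := by
  have : NeZero (p ^ δ) := ⟨pow_ne_zero _ hp.ne_zero⟩
  have hβ : p ^ padicValNat p n ∣ n := pow_padicValNat_dvd
  constructor
  · intro hu
    have hcop : (p ^ δ).Coprime (n / p ^ padicValNat p n) := by
      rw [← Nat.factorization_def n hp]
      exact (Nat.coprime_ordCompl hp (Nat.one_le_iff_ne_zero.mp hn)).pow_left δ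
    obtain ⟨l, hlδ, hlm⟩ := Nat.chineseRemainder hcop (u : ZMod (p ^ δ)).val 1
    have hlu : (l : ZMod (p ^ δ)) = u := by
      rw [(ZMod.natCast_eq_natCast_iff _ _ _).mpr hlδ, ZMod.natCast_zmod_val]
    have hlβ : l ≡ 1 [MOD p ^ padicValNat p n] := by
      rw [← ZMod.natCast_eq_natCast_iff, Nat.cast_one, ← hu, ← hlu, map_natCast]
    have hln : l ≡ 1 [MOD n] := by
      have h := (Nat.modEq_and_modEq_iff_modEq_mul
        (hcop.coprime_dvd_left (pow_dvd_pow p hδ))).mp ⟨hlβ, hlm⟩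
      rwa [Nat.mul_div_cancel' hβ] at h
    have hpl : ¬ p ∣ l := fun h =>
      hp.one_lt.ne' (Nat.dvd_one.mp (((hln.of_dvd hpn).dvd_iff dvd_rfl).mp h))
    refine ⟨1, l, one_pos, Nat.pos_of_ne_zero ?_, hln.symm, hp.not_dvd_one, hpl, ?_⟩
    · rintro rfl
      exact hpl (dvd_zero p)
    · rw [hlu, Nat.cast_one, mul_one]
  · rintro ⟨k, l, -, -, hkl, hpk, -, hlu⟩
    have hk : IsUnit (k : ZMod (p ^ padicValNat p n)) :=
      (ZMod.isUnit_iff_coprime _ _).mpr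
        (((hp.coprime_iff_not_dvd.mpr hpk).symm).pow_right _)
    have h := congrArg (ZMod.castHom (pow_dvd_pow p hδ) (ZMod (p ^ padicValNat p n))) hlu
    rw [map_mul, map_natCast, map_natCast,
      ← (ZMod.natCast_eq_natCast_iff _ _ _).mpr (hkl.of_dvd hβ)] at h
    exact hk.mul_right_cancel (by rw [one_mul, ← h])
end
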